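/- Let f(x; w) = W_L ⋯ W_1 x be a deep linear network of depth L with single output (d_L = 1), with each W_l nonzero, output scale F(w) = √d₀·∏_{l=1}^L ‖W_l‖_*, and m inputs x₁,…,x_m ∈ ℝ^{d₀} with ‖xᵢ‖₂ = √d₀. Let η > 0 and suppose the perturbation Δw = (ΔW_1,…,ΔW_L) satisfies the equal-layerwise-update condition ‖ΔW_l‖_* = (η/L)·‖W_l‖_* for every l. Then: (1) ‖Δf_X‖₂ ≤ √m · F(w) · (e^η − 1); and (2) ‖Δf_X − ∇_w f_X Δw‖₂ ≤ √m · F(w) · (e^η − η − 1), where Δf_X and the linearisation ∇_w f_X Δw are as in the architectural perturbation bounds for deep linear networks. -/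

import Mathlib

/-- The spectral norm (largest singular value) of a real matrix, as the operator norm of
the induced linear map between Euclidean spaces. -/
noncomputable def specNorm {p q : ℕ} (A : Matrix (Fin p) (Fin q) ℝ) : ℝ :=
  ‖LinearMap.toContinuousLinearMap (Matrix.toEuclideanLin A)‖

/-- A deep linear network: `netFwd d W L x = W_{L} ⋯ W_1 x` where the `l`-th weight matrix
(0-indexed) `W l` has dimensions `d (l+1) × d l`. -/
def netFwd (d : ℕ → ℕ) (W : ∀ l : ℕ, Matrix (Fin (d (l + 1))) (Fin (d l)) ℝ) :
    (L : ℕ) → (Fin (d 0) → ℝ) → Fin (d L) → ℝ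
  | 0, x => x
  | L + 1, x => (W L).mulVec (netFwd d W L x)

/-- The Euclidean norm of a vector in `ℝⁿ`. -/
noncomputable def euclNorm {n : ℕ} (v : Fin n → ℝ) : ℝ :=
  Real.sqrt (∑ i, (v i) ^ 2)

theorem euclNorm_eq_norm {n : ℕ} (v : Fin n → ℝ) : euclNorm v = ‖WithLp.toLp 2 v‖ := by
  simp [euclNorm, EuclideanSpace.norm_eq]

theorem euclNorm_add_le {n : ℕ} (v w : Fin n → ℝ) :
    euclNorm (v + w) ≤ euclNorm v + euclNorm w := by
  simp only [euclNorm_eq_norm, WithLp.toLp_add]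
  exact norm_add_le _ _

theorem euclNorm_nonneg {n : ℕ} (v : Fin n → ℝ) : 0 ≤ euclNorm v := Real.sqrt_nonneg _

theorem specNorm_nonneg {p q : ℕ} (A : Matrix (Fin p) (Fin q) ℝ) : 0 ≤ specNorm A :=
  norm_nonneg _

theorem euclNorm_mulVec_le {p q : ℕ} (A : Matrix (Fin p) (Fin q) ℝ) (v : Fin q → ℝ) :
    euclNorm (A.mulVec v) ≤ specNorm A * euclNorm v := by
  simp only [euclNorm_eq_norm, specNorm]
  have h := (LinearMap.toContinuousLinearMap (Matrix.toEuclideanLin A)).le_opNorm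
    (WithLp.toLp 2 v)
  simpa using h

theorem abs_sum_le_euclNorm {n : ℕ} (hn : n = 1) (v : Fin n → ℝ) :
    |∑ j, v j| ≤ euclNorm v := by
  subst hn
  simp [euclNorm, Real.sqrt_sq_eq_abs]

theorem euclNorm_le_of_abs_le {m : ℕ} (v : Fin m → ℝ) (c : ℝ) (hc : 0 ≤ c)
    (h : ∀ i, |v i| ≤ c) : euclNorm v ≤ Real.sqrt m * c := by
  unfold euclNorm
  rw [Real.sqrt_le_left (by positivity), mul_pow, Real.sq_sqrt (by positivity)]
  calc ∑ i, v i ^ 2 ≤ ∑ _i : Fin m, c ^ 2 :=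
        Finset.sum_le_sum fun i _ => sq_le_sq' (abs_le.mp (h i)).1 (abs_le.mp (h i)).2
    _ = m * c ^ 2 := by simp

/-- The linearised perturbation at depth `n`. -/
def netLin (d : ℕ → ℕ) (W ΔW : ∀ l : ℕ, Matrix (Fin (d (l + 1))) (Fin (d l)) ℝ) (n : ℕ)
    (x : Fin (d 0) → ℝ) : Fin (d n) → ℝ :=
  ∑ l ∈ Finset.range n, netFwd d (fun k => if k = l then ΔW k else W k) n x

theorem netFwd_congr (d : ℕ → ℕ) (W V : ∀ l : ℕ, Matrix (Fin (d (l + 1))) (Fin (d l)) ℝ)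
    (x : Fin (d 0) → ℝ) (n : ℕ) (h : ∀ l < n, W l = V l) : netFwd d W n x = netFwd d V n x := by
  induction n with
  | zero => rfl
  | succ n ih =>
    simp only [netFwd]
    rw [ih fun l hl => h l (by omega), h n (by omega)]

theorem netLin_succ (d : ℕ → ℕ) (W ΔW : ∀ l : ℕ, Matrix (Fin (d (l + 1))) (Fin (d l)) ℝ) (n : ℕ)
    (x : Fin (d 0) → ℝ) :
    netLin d W ΔW (n + 1) x =
      (W n).mulVec (netLin d W ΔW n x) + (ΔW n).mulVec (netFwd d W n x) := by
  unfold netLin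
  rw [Finset.sum_range_succ, Matrix.mulVec_sum]
  congr 1
  · refine Finset.sum_congr rfl fun l hl => ?_
    have hl' : n ≠ l := by
      have := Finset.mem_range.mp hl
      omega
    simp only [netFwd, if_neg hl']
  · simp only [netFwd, if_true]
    rw [netFwd_congr d (fun k => if k = n then ΔW k else W k) W x n]
    intro l hl
    exact if_neg (by omega)

theorem net_bounds (L : ℕ) (d : ℕ → ℕ)
    (W ΔW : ∀ l : ℕ, Matrix (Fin (d (l + 1))) (Fin (d l)) ℝ) (a : ℝ) (ha : 0 ≤ a)
    (h : ∀ l < L, specNorm (ΔW l) = a * specNorm (W l)) (x : Fin (d 0) → ℝ)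
    (n : ℕ) (hn : n ≤ L) :
    euclNorm (netFwd d W n x) ≤ euclNorm x * ∏ l ∈ Finset.range n, specNorm (W l) ∧
    euclNorm (netFwd d (fun l => W l + ΔW l) n x - netFwd d W n x) ≤
      (euclNorm x * ∏ l ∈ Finset.range n, specNorm (W l)) * ((1 + a) ^ n - 1) ∧
    euclNorm (netFwd d (fun l => W l + ΔW l) n x - netFwd d W n x - netLin d W ΔW n x) ≤
      (euclNorm x * ∏ l ∈ Finset.range n, specNorm (W l)) * ((1 + a) ^ n - 1 - n * a) := by
  induction n with
  | zero => simp [netFwd, netLin, euclNorm]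
  | succ n ih =>
    obtain ⟨hA, hB, hC⟩ := ih (by omega)
    have hs := h n (by omega)
    have hw := specNorm_nonneg (W n)
    have e1 : netFwd d (fun l => W l + ΔW l) (n + 1) x - netFwd d W (n + 1) x =
        ((W n).mulVec (netFwd d (fun l => W l + ΔW l) n x - netFwd d W n x) +
          (ΔW n).mulVec (netFwd d (fun l => W l + ΔW l) n x - netFwd d W n x)) +
          (ΔW n).mulVec (netFwd d W n x) := by
      simp only [netFwd, Matrix.add_mulVec, Matrix.mulVec_sub]
      abel
    have e2 : netFwd d (fun l => W l + ΔW l) (n + 1) x - netFwd d W (n + 1) x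
          - netLin d W ΔW (n + 1) x =
        (W n).mulVec (netFwd d (fun l => W l + ΔW l) n x - netFwd d W n x
          - netLin d W ΔW n x) +
          (ΔW n).mulVec (netFwd d (fun l => W l + ΔW l) n x - netFwd d W n x) := by
      rw [netLin_succ]
      simp only [netFwd, Matrix.add_mulVec, Matrix.mulVec_sub]
      abel
    rw [e2, e1, Finset.prod_range_succ]
    set B := netFwd d (fun l => W l + ΔW l) n x - netFwd d W n x
    set C := B - netLin d W ΔW n x
    set P := ∏ l ∈ Finset.range n, specNorm (W l)
    have hA' := mul_le_mul_of_nonneg_left hA hw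
    have hB' := mul_le_mul_of_nonneg_left hB hw
    have hC' := mul_le_mul_of_nonneg_left hC hw
    have hA2 := mul_le_mul_of_nonneg_left hA' ha
    have hB2 := mul_le_mul_of_nonneg_left hB' ha
    have w1 := euclNorm_mulVec_le (W n) (netFwd d W n x)
    have w2 := euclNorm_mulVec_le (W n) B
    have w3 := euclNorm_mulVec_le (W n) C
    have v1 := euclNorm_mulVec_le (ΔW n) (netFwd d W n x)
    have v2 := euclNorm_mulVec_le (ΔW n) B
    rw [hs, mul_assoc] at v1 v2
    refine ⟨?_, ?_, ?_⟩
    · simp only [netFwd]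
      linarith
    · have t1 := euclNorm_add_le ((W n).mulVec B + (ΔW n).mulVec B)
        ((ΔW n).mulVec (netFwd d W n x))
      have t2 := euclNorm_add_le ((W n).mulVec B) ((ΔW n).mulVec B)
      rw [pow_succ]
      linarith
    · have t2 := euclNorm_add_le ((W n).mulVec C) ((ΔW n).mulVec B)
      rw [pow_succ]
      push_cast
      linarith

/-- Architectural perturbation bounds under equal layerwise updates:
if `‖ΔWₗ‖_* = (η/L)·‖Wₗ‖_*` for every layer, then for a single-output deep linear network
on `m` inputs of norm `√d₀`,
`‖Δf_X‖₂ ≤ √m·F(w)·(e^η − 1)` and `‖Δf_X − ∇_w f_X Δw‖₂ ≤ √m·F(w)·(e^η − η − 1)`. -/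
theorem deep_linear_network_equal_layerwise_bounds (L : ℕ) (d : ℕ → ℕ) (hdL : d L = 1)
    (W ΔW : ∀ l : ℕ, Matrix (Fin (d (l + 1))) (Fin (d l)) ℝ)
    (hW : ∀ l < L, W l ≠ 0)
    (η : ℝ) (hη : 0 < η)
    (hansatz : ∀ l < L, specNorm (ΔW l) = (η / (L : ℝ)) * specNorm (W l))
    (m : ℕ) (x : Fin m → Fin (d 0) → ℝ)
    (hx : ∀ i, euclNorm (x i) = Real.sqrt (d 0)) :
    euclNorm (fun i =>
        (∑ j, netFwd d (fun l => W l + ΔW l) L (x i) j) - ∑ j, netFwd d W L (x i) j)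
      ≤ Real.sqrt m * (Real.sqrt (d 0) * ∏ l ∈ Finset.range L, specNorm (W l)) *
          (Real.exp η - 1) ∧
    euclNorm (fun i =>
        ((∑ j, netFwd d (fun l => W l + ΔW l) L (x i) j) - ∑ j, netFwd d W L (x i) j)
          - ∑ l ∈ Finset.range L,
              ∑ j, netFwd d (fun k => if k = l then ΔW k else W k) L (x i) j)
      ≤ Real.sqrt m * (Real.sqrt (d 0) * ∏ l ∈ Finset.range L, specNorm (W l)) *
          (Real.exp η - η - 1) := by
  have hLn : (0 : ℝ) ≤ L := Nat.cast_nonneg L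
  have ha : 0 ≤ η / (L : ℝ) := by positivity
  have hexp : (1 + η / (L : ℝ)) ^ L ≤ Real.exp η := by
    rcases Nat.eq_zero_or_pos L with h0 | hpos
    · subst h0
      simpa using hη.le
    · have hL : (L : ℝ) ≠ 0 := by positivity
      calc (1 + η / (L : ℝ)) ^ L ≤ (Real.exp (η / L)) ^ L := by
            gcongr
            linarith [Real.add_one_le_exp (η / (L : ℝ))]
        _ = Real.exp η := by
            rw [← Real.exp_nat_mul]
            congr 1
            field_simp
  have hexp2 : (1 + η / (L : ℝ)) ^ L - 1 - L * (η / (L : ℝ)) ≤ Real.exp η - η - 1 := by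
    rcases Nat.eq_zero_or_pos L with h0 | hpos
    · subst h0
      have := Real.add_one_le_exp η
      simp
      linarith
    · have hL : (L : ℝ) ≠ 0 := by positivity
      rw [mul_div_cancel₀ _ hL]
      linarith
  have hP : 0 ≤ Real.sqrt (d 0) * ∏ l ∈ Finset.range L, specNorm (W l) :=
    mul_nonneg (Real.sqrt_nonneg _) (Finset.prod_nonneg fun l _ => specNorm_nonneg _)
  have hη1 := Real.add_one_le_exp η
  constructor
  · rw [mul_assoc (Real.sqrt m)]
    refine euclNorm_le_of_abs_le _ _ (mul_nonneg hP ?_) fun i => ?_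
    · linarith
    obtain ⟨-, hB, -⟩ := net_bounds L d W ΔW _ ha hansatz (x i) L le_rfl
    rw [hx i] at hB
    have h1 := abs_sum_le_euclNorm hdL
      (netFwd d (fun l => W l + ΔW l) L (x i) - netFwd d W L (x i))
    simp only [Pi.sub_apply, Finset.sum_sub_distrib] at h1
    refine h1.trans (hB.trans (mul_le_mul_of_nonneg_left (by linarith) hP))
  · rw [mul_assoc (Real.sqrt m)]
    refine euclNorm_le_of_abs_le _ _ (mul_nonneg hP ?_) fun i => ?_
    · linarith
    obtain ⟨-, -, hC⟩ := net_bounds L d W ΔW _ ha hansatz (x i) L le_rfl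
    rw [hx i] at hC
    have h1 := abs_sum_le_euclNorm hdL
      (netFwd d (fun l => W l + ΔW l) L (x i) - netFwd d W L (x i) - netLin d W ΔW L (x i))
    simp only [Pi.sub_apply, Finset.sum_sub_distrib, netLin, Finset.sum_apply] at h1
    rw [Finset.sum_comm (s := Finset.univ) (t := Finset.range L)] at h1
    exact h1.trans (hC.trans (mul_le_mul_of_nonneg_left hexp2 hP))
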